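/- If Y = (Y_1,…,Y_d) is a centered Gaussian vector in ℝ^d with E[Y_j²] ≥ σ̲² > 0 for all j, then for every y ∈ ℝ^d and t > 0, |P(Y ≤ y + t𝟙) − P(Y ≤ y)| ≤ (t/σ̲)(√(2 log d) + 2), where Y ≤ y means coordinatewise and 𝟙 is the all-ones vector. -/

import Mathlib

open MeasureTheory ProbabilityTheory

open Filter Topology in
/-- Mills ratio bound for a centered Gaussian density at a nonnegative point. -/
lemma gaussianPDFReal_le_mul_tail_of_nonneg {v : NNReal} (hv : v ≠ 0) {z : ℝ} (hz : 0 ≤ z) :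
    √v * gaussianPDFReal 0 v z ≤ (z / √v + 1) * ∫ x in Set.Ioi z, gaussianPDFReal 0 v x := by
  have hv0 : (0 : ℝ) < v := by exact_mod_cast pos_iff_ne_zero.2 hv
  set r : ℝ := √v with hr
  have hr0 : 0 < r := Real.sqrt_pos.2 hv0
  have hrv : r ^ 2 = v := Real.sq_sqrt hv0.le
  have hp : ∀ x, HasDerivAt (gaussianPDFReal 0 v) (-(x / r ^ 2) * gaussianPDFReal 0 v x) x := by
    intro x
    have h1 : HasDerivAt (fun x : ℝ => -(x - 0) ^ 2 / (2 * v)) (-(x / r ^ 2)) x := by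
      refine (((((hasDerivAt_id x).sub_const 0).pow 2).neg).div_const (2 * (v : ℝ))).congr_deriv ?_
      rw [hrv]
      simp
      field_simp
    refine ((h1.exp).const_mul (√(2 * Real.pi * v))⁻¹).congr_deriv ?_
    simp only [gaussianPDFReal]
    ring
  let F : ℝ → ℝ := fun x => -(gaussianPDFReal 0 v x * (r / (x / r + 1)))
  let F' : ℝ → ℝ := fun x => gaussianPDFReal 0 v x *
    (x / r / (x / r + 1) + 1 / (x / r + 1) ^ 2)
  have hpos : ∀ x, z ≤ x → 0 < x / r + 1 := fun x hx => by
    have : 0 ≤ x / r := div_nonneg (hz.trans hx) hr0.le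
    linarith
  have hF : ∀ x ∈ Set.Ici z, HasDerivAt F (F' x) x := by
    intro x hx
    have hx' := hpos x hx
    have h1 : HasDerivAt (fun x : ℝ => x / r + 1) (1 / r) x :=
      ((hasDerivAt_id x).div_const r).add_const 1
    refine (((hp x).mul ((hasDerivAt_const x r).div h1 hx'.ne')).neg).congr_deriv ?_
    simp only [F', Pi.div_apply]
    have : x + r ≠ 0 := by have : 0 ≤ x := hz.trans hx; positivity
    field_simp
    ring
  have hlim : Tendsto F atTop (𝓝 0) := by
    have h1 : Tendsto (fun x : ℝ => (√(2 * Real.pi * v))⁻¹ * (r / (x / r + 1))) atTop (𝓝 0) := by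
      rw [← mul_zero ((√(2 * Real.pi * v))⁻¹)]
      refine Tendsto.const_mul _ (Tendsto.div_atTop tendsto_const_nhds ?_)
      exact tendsto_atTop_add_const_right _ _ (tendsto_id.atTop_div_const hr0)
    rw [← neg_zero]
    refine Tendsto.neg (squeeze_zero' ?_ ?_ h1)
    · filter_upwards [eventually_ge_atTop z] with x hx
      exact mul_nonneg (gaussianPDFReal_nonneg _ _ _) (div_nonneg hr0.le (hpos x hx).le)
    · filter_upwards [eventually_ge_atTop z] with x hx
      refine mul_le_mul_of_nonneg_right ?_ (div_nonneg hr0.le (hpos x hx).le)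
      rw [gaussianPDFReal]
      refine mul_le_of_le_one_right (by positivity) (Real.exp_le_one_iff.2 ?_)
      exact div_nonpos_of_nonpos_of_nonneg (by nlinarith [sq_nonneg (x - 0)]) (by positivity)
  have hF'0 : ∀ x ∈ Set.Ioi z, 0 ≤ F' x := by
    intro x hx
    have := hpos x (le_of_lt hx)
    have h0 : 0 ≤ x / r := div_nonneg (hz.trans (le_of_lt hx)) hr0.le
    exact mul_nonneg (gaussianPDFReal_nonneg _ _ _) (by positivity)
  have hint := integral_Ioi_of_hasDerivAt_of_nonneg' hF hF'0 hlim
  have hle : ∫ x in Set.Ioi z, F' x ≤ ∫ x in Set.Ioi z, gaussianPDFReal 0 v x := by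
    refine setIntegral_mono_on (integrableOn_Ioi_deriv_of_nonneg' hF hF'0 hlim)
      (integrable_gaussianPDFReal 0 v).integrableOn measurableSet_Ioi fun x hx => ?_
    have h1 := hpos x (le_of_lt hx)
    have h0 : 0 ≤ x / r := div_nonneg (hz.trans (le_of_lt hx)) hr0.le
    refine mul_le_of_le_one_right (gaussianPDFReal_nonneg _ _ _) ?_
    rw [div_add_div _ _ h1.ne' (by positivity), div_le_one (by positivity)]
    nlinarith [mul_nonneg h0 h0, mul_nonneg h0 (mul_nonneg h0 h0)]
  rw [hint] at hle
  simp only [F, sub_neg_eq_add, zero_add] at hle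
  have h1 := hpos z le_rfl
  calc r * gaussianPDFReal 0 v z
      = (z / r + 1) * (gaussianPDFReal 0 v z * (r / (z / r + 1))) := by field_simp
    _ ≤ _ := mul_le_mul_of_nonneg_left hle h1.le

/-- Mills ratio bound for a centered Gaussian density. -/
lemma gaussianPDFReal_le_mul_tail {v : NNReal} (hv : v ≠ 0) (z : ℝ) :
    √v * gaussianPDFReal 0 v z ≤
      (max (z / √v) 0 + 1) * (gaussianReal 0 v (Set.Ioi z)).toReal := by
  have htail : ∀ z, (gaussianReal 0 v (Set.Ioi z)).toReal =
      ∫ x in Set.Ioi z, gaussianPDFReal 0 v x := fun z => by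
    rw [gaussianReal_apply_eq_integral 0 hv, ENNReal.toReal_ofReal]
    exact integral_nonneg fun x => gaussianPDFReal_nonneg _ _ _
  rcases le_total 0 z with hz | hz
  · rw [max_eq_left (by positivity), htail]
    exact gaussianPDFReal_le_mul_tail_of_nonneg hv hz
  · rw [max_eq_right (div_nonpos_of_nonpos_of_nonneg hz (Real.sqrt_nonneg _))]
    have h0 := gaussianPDFReal_le_mul_tail_of_nonneg hv le_rfl
    rw [zero_div, ← htail] at h0
    calc √v * gaussianPDFReal 0 v z ≤ √v * gaussianPDFReal 0 v 0 := by
          refine mul_le_mul_of_nonneg_left ?_ (Real.sqrt_nonneg _)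
          rw [gaussianPDFReal, gaussianPDFReal]
          gcongr 2
          rw [sub_zero, sub_zero, zero_pow two_ne_zero, neg_zero, zero_div]
          exact div_nonpos_of_nonpos_of_nonneg (neg_nonpos.2 (sq_nonneg z)) (by positivity)
      _ ≤ _ := h0
      _ ≤ _ := by
          refine mul_le_mul_of_nonneg_left ?_ (by norm_num)
          exact ENNReal.toReal_mono (measure_ne_top _ _) (measure_mono (Set.Ioi_subset_Ioi hz))

/-- A weighted sum of centered Gaussian densities is controlled by the same sum of tails. -/
lemma sum_gaussianPDFReal_mul_le {d : ℕ} (hd : 1 ≤ d) {v : Fin d → NNReal} {σ : ℝ} (hσ : 0 < σ)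
    (hv : ∀ j, σ ^ 2 ≤ v j) (z g : Fin d → ℝ) (hg0 : ∀ j, 0 ≤ g j) (hg1 : ∀ j, g j ≤ 1)
    (hsum : ∑ j, (gaussianReal 0 (v j) (Set.Ioi (z j))).toReal * g j ≤ 1) :
    ∑ j, gaussianPDFReal 0 (v j) (z j) * g j ≤ 1 / σ * (√(2 * Real.log d) + 2) := by
  have hd0 : (0 : ℝ) < d := by exact_mod_cast hd
  have hlog : 0 ≤ Real.log d := Real.log_nonneg (by exact_mod_cast hd)
  set a := √(2 * Real.log d) with ha
  have ha0 : 0 ≤ a := Real.sqrt_nonneg _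
  have ha2 : a ^ 2 = 2 * Real.log d := Real.sq_sqrt (by positivity)
  have key : ∀ j, gaussianPDFReal 0 (v j) (z j) * g j ≤
      1 / σ * ((a + 1) * ((gaussianReal 0 (v j) (Set.Ioi (z j))).toReal * g j) + 1 / d) := by
    intro j
    have hv0 : (0 : ℝ) < v j := lt_of_lt_of_le (by positivity) (hv j)
    have hr0 : 0 < √(v j : ℝ) := Real.sqrt_pos.2 hv0
    have hσr : σ ≤ √(v j : ℝ) := Real.le_sqrt_of_sq_le (hv j)
    have hp0 := gaussianPDFReal_nonneg 0 (v j) (z j)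
    set T := (gaussianReal 0 (v j) (Set.Ioi (z j))).toReal with hT
    have hT0 : 0 ≤ T := ENNReal.toReal_nonneg
    have main : √(v j : ℝ) * gaussianPDFReal 0 (v j) (z j) * g j ≤ (a + 1) * (T * g j) + 1 / d := by
      rcases le_or_gt (z j / √(v j : ℝ)) a with h | h
      · have h1 := gaussianPDFReal_le_mul_tail (v := v j) (by exact_mod_cast hv0.ne') (z j)
        have h2 : max (z j / √(v j : ℝ)) 0 ≤ a := max_le h ha0
        have h3 : √(v j : ℝ) * gaussianPDFReal 0 (v j) (z j) * g j ≤ (a + 1) * T * g j := by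
          refine mul_le_mul_of_nonneg_right (h1.trans ?_) (hg0 j)
          gcongr
        have : (0 : ℝ) ≤ 1 / d := by positivity
        nlinarith
      · have h1 : √(v j : ℝ) * gaussianPDFReal 0 (v j) (z j) ≤ 1 / d := by
          have e1 : (1 : ℝ) / d = Real.exp (-(a ^ 2) / 2) := by
            rw [ha2, show -(2 * Real.log d) / 2 = -Real.log d by ring, Real.exp_neg,
              Real.exp_log hd0, one_div]
          have e2 : -(z j - 0) ^ 2 / (2 * (v j : ℝ)) ≤ -(a ^ 2) / 2 := by
            have : (z j / √(v j : ℝ)) ^ 2 = z j ^ 2 / v j := by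
              rw [div_pow, Real.sq_sqrt hv0.le]
            have h4 : a ^ 2 ≤ z j ^ 2 / v j := by rw [← this]; gcongr
            have h5 : -(z j - 0) ^ 2 / (2 * (v j : ℝ)) = -(z j ^ 2 / v j) / 2 := by
              field_simp; ring
            rw [h5]; linarith
          have e3 : √(v j : ℝ) * (√(2 * Real.pi * v j))⁻¹ ≤ 1 := by
            rw [← div_eq_mul_inv, div_le_one (by positivity)]
            refine Real.sqrt_le_sqrt ?_
            nlinarith [Real.pi_gt_three]
          rw [e1, gaussianPDFReal, ← mul_assoc]
          calc _ ≤ 1 * Real.exp (-(z j - 0) ^ 2 / (2 * (v j : ℝ))) :=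
                mul_le_mul_of_nonneg_right e3 (Real.exp_pos _).le
            _ ≤ _ := by rw [one_mul]; exact Real.exp_le_exp.2 e2
        have h2 : √(v j : ℝ) * gaussianPDFReal 0 (v j) (z j) * g j ≤ 1 / d :=
          (mul_le_of_le_one_right (by positivity) (hg1 j)).trans h1
        have : 0 ≤ (a + 1) * (T * g j) :=
          mul_nonneg (by positivity) (mul_nonneg hT0 (hg0 j))
        linarith
    rw [one_div_mul_eq_div, le_div_iff₀ hσ]
    refine le_trans ?_ main
    have : gaussianPDFReal 0 (v j) (z j) * g j * σ ≤
        gaussianPDFReal 0 (v j) (z j) * g j * √(v j : ℝ) :=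
      mul_le_mul_of_nonneg_left hσr (mul_nonneg hp0 (hg0 j))
    linarith
  calc _ ≤ ∑ j, 1 / σ * ((a + 1) * ((gaussianReal 0 (v j) (Set.Ioi (z j))).toReal * g j) + 1 / d) :=
        Finset.sum_le_sum fun j _ => key j
    _ = 1 / σ * ((a + 1) * ∑ j, (gaussianReal 0 (v j) (Set.Ioi (z j))).toReal * g j + 1) := by
        rw [← Finset.mul_sum, Finset.sum_add_distrib, ← Finset.mul_sum]
        simp [hd0.ne']
    _ ≤ _ := by
        refine mul_le_mul_of_nonneg_left ?_ (by positivity)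
        nlinarith

/-- Cauchy-Schwarz inequality for the covariance. -/
lemma sq_covariance_le_variance_mul_variance {Ω : Type*} {mΩ : MeasurableSpace Ω} {P : Measure Ω}
    [IsProbabilityMeasure P] {X Y : Ω → ℝ} (hX : MemLp X 2 P) (hY : MemLp Y 2 P) :
    cov[X, Y; P] ^ 2 ≤ Var[X; P] * Var[Y; P] := by
  have h : ∀ t : ℝ, 0 ≤ Var[Y; P] * (t * t) + (-2 * cov[X, Y; P]) * t + Var[X; P] := by
    intro t
    have hY' : MemLp (fun ω => t * Y ω) 2 P := hY.const_mul t
    have h0 := variance_nonneg (fun ω => X ω - t * Y ω) P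
    rw [variance_fun_sub hX hY', variance_const_mul, covariance_const_mul_right] at h0
    linarith
  have := discrim_le_zero h
  rw [discrim] at this
  linarith

/-- In a Gaussian vector, the residuals of the linear regression on a coordinate are independent
of that coordinate. -/
lemma indepFun_eval_regression_residual {ι : Type*} [Fintype ι] {μ : Measure (ι → ℝ)}
    [IsGaussian μ] (j : ι) (c : ι → ℝ)
    (hc : ∀ k, cov[fun x : ι → ℝ => x k, fun x : ι → ℝ => x j; μ] =
      c k * Var[fun x : ι → ℝ => x j; μ]) :
    IndepFun (fun x : ι → ℝ => x j) (fun (x : ι → ℝ) k => x k - c k * x j) μ := by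
  have hid : HasGaussianLaw (fun x : ι → ℝ => x) μ := IsGaussian.hasGaussianLaw_id
  have hL : ∀ k, MemLp (fun x : ι → ℝ => x k) 2 μ := fun k => (hid.eval k).memLp_two
  let L : (ι → ℝ) →L[ℝ] (Unit → ℝ) × (ι → ℝ) :=
    (ContinuousLinearMap.pi fun _ => ContinuousLinearMap.proj j).prod
      (ContinuousLinearMap.pi fun k =>
        ContinuousLinearMap.proj k - c k • ContinuousLinearMap.proj j)
  have hG : HasGaussianLaw (fun x : ι → ℝ => (fun _ : Unit => x j, fun k => x k - c k * x j)) μ :=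
    hid.map_fun L
  have hind := hG.indepFun_of_covariance_eval (X := fun (_ : Unit) (x : ι → ℝ) => x j)
    (Y := fun k (x : ι → ℝ) => x k - c k * x j) fun _ k => by
      rw [covariance_fun_sub_right (hL j) (hL k) ((hL j).const_mul _), covariance_const_mul_right,
        covariance_self (hL j).aemeasurable, covariance_comm, hc, sub_self]
  exact hind.comp (φ := fun f : Unit → ℝ => f ()) (measurable_pi_apply ()) measurable_id

/-- Disintegration of the law of an independent pair whose first component is Gaussian. -/
lemma measure_pair_mem_eq_lintegral_gaussianPDF {Ω E : Type*} {mΩ : MeasurableSpace Ω}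
    {mE : MeasurableSpace E} {P : Measure Ω} [IsProbabilityMeasure P] {X : Ω → ℝ} {R : Ω → E}
    (hX : Measurable X) (hR : Measurable R) {v : NNReal} (hv : v ≠ 0)
    (hlaw : P.map X = gaussianReal 0 v) (hind : IndepFun X R P) {S : Set (ℝ × E)}
    (hS : MeasurableSet S) :
    P {ω | (X ω, R ω) ∈ S} = ∫⁻ u, gaussianPDF 0 v u * P {ω | (u, R ω) ∈ S} := by
  have hm : Measurable fun u => P.map R (Prod.mk u ⁻¹' S) := by
    have := Measure.isProbabilityMeasure_map (μ := P) hR.aemeasurable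
    exact measurable_measure_prodMk_left hS
  have := Measure.isProbabilityMeasure_map (μ := P) hR.aemeasurable
  calc P {ω | (X ω, R ω) ∈ S} = P.map (fun ω => (X ω, R ω)) S :=
        (Measure.map_apply (hX.prodMk hR) hS).symm
    _ = ∫⁻ u, P.map R (Prod.mk u ⁻¹' S) ∂(gaussianReal 0 v) := by
        rw [(indepFun_iff_map_prod_eq_prod_map_map hX.aemeasurable hR.aemeasurable).1 hind,
          Measure.prod_apply hS, hlaw]
    _ = ∫⁻ u, gaussianPDF 0 v u * P.map R (Prod.mk u ⁻¹' S) := by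
        rw [gaussianReal_of_var_ne_zero 0 hv,
          lintegral_withDensity_eq_lintegral_mul _ (measurable_gaussianPDF 0 v) hm]
        rfl
    _ = _ := by
        refine lintegral_congr fun u => ?_
        rw [Measure.map_apply hR (measurable_prodMk_left hS)]
        rfl

theorem stmt19 (d : ℕ) (hd : 1 ≤ d) (μ : Measure (Fin d → ℝ)) [IsProbabilityMeasure μ]
    -- `μ` is a centered Gaussian law: every linear functional has a centered Gaussian law
    (hGauss : ∀ l : Fin d → ℝ, ∃ v : NNReal,
      Measure.map (fun x => ∑ j, l j * x j) μ = gaussianReal 0 v)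
    (σ : ℝ) (hσ : 0 < σ) (hvar : ∀ j, σ ^ 2 ≤ ∫ x, (x j) ^ 2 ∂μ)
    (y : Fin d → ℝ) (t : ℝ) (ht : 0 < t) :
    |(μ {x | ∀ j, x j ≤ y j + t}).toReal - (μ {x | ∀ j, x j ≤ y j}).toReal| ≤
      (t / σ) * (Real.sqrt (2 * Real.log d) + 2) := by
  have hGμ : IsGaussian μ := by
    refine isGaussian_of_map_eq_gaussianReal fun L => ?_
    obtain ⟨v, hv⟩ := hGauss fun j => L (Pi.single j 1)
    refine ⟨0, v, ?_⟩
    rw [← hv]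
    congr 1
    ext x
    conv_lhs => rw [pi_eq_sum_univ' x]
    simp [mul_comm]
  have hlaw : ∀ j, ∃ v : NNReal, μ.map (fun x => x j) = gaussianReal 0 v := fun j => by
    obtain ⟨v, hv⟩ := hGauss (Pi.single j 1)
    exact ⟨v, by simpa [Pi.single_apply] using hv⟩
  choose v hv using hlaw
  have hid : HasGaussianLaw (fun x : Fin d → ℝ => x) μ := IsGaussian.hasGaussianLaw_id
  have hL : ∀ k, MemLp (fun x : Fin d → ℝ => x k) 2 μ := fun k => (hid.eval k).memLp_two
  have hVar : ∀ j, Var[fun x : Fin d → ℝ => x j; μ] = v j := fun j => by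
    rw [← variance_id_gaussianReal (μ := 0) (v := v j), ← hv j,
      variance_id_map (measurable_pi_apply j).aemeasurable]
  have hmean : ∀ j, ∫ x, x j ∂μ = 0 := fun j => by
    have h : ∫ u, id u ∂gaussianReal 0 (v j) = 0 := integral_id_gaussianReal
    rwa [← hv j, integral_map (φ := fun x : Fin d → ℝ => x j) (measurable_pi_apply j).aemeasurable
      measurable_id.aestronglyMeasurable] at h
  have hσv : ∀ j, σ ^ 2 ≤ v j := fun j => by
    rw [← hVar, variance_eq_integral (measurable_pi_apply j).aemeasurable, hmean]
    simpa using hvar j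
  have hv0 : ∀ j, (0 : ℝ) < v j := fun j => lt_of_lt_of_le (by positivity) (hσv j)
  have hvne : ∀ j, v j ≠ 0 := fun j => by exact_mod_cast (hv0 j).ne'
  let c : Fin d → Fin d → ℝ := fun j k =>
    cov[fun x : Fin d → ℝ => x k, fun x : Fin d → ℝ => x j; μ] / v j
  have hc : ∀ j k, cov[fun x : Fin d → ℝ => x k, fun x : Fin d → ℝ => x j; μ] =
      c j k * Var[fun x : Fin d → ℝ => x j; μ] :=
    fun j k => by rw [hVar, div_mul_cancel₀ _ (hv0 j).ne']
  have hcc : ∀ j k, c j k * c k j ≤ 1 := fun j k => by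
    have h := sq_covariance_le_variance_mul_variance (hL j) (hL k)
    rw [hVar, hVar] at h
    simp only [c]
    rw [covariance_comm (fun x : Fin d → ℝ => x k), div_mul_div_comm, div_le_one
      (mul_pos (hv0 j) (hv0 k))]
    linarith
  let R : Fin d → (Fin d → ℝ) → Fin d → ℝ := fun j x k => x k - c j k * x j
  have hR : ∀ j, Measurable (R j) := fun j => by fun_prop
  have hind : ∀ j, IndepFun (fun x : Fin d → ℝ => x j) (R j) μ := fun j =>
    indepFun_eval_regression_residual j (c j) (hc j)
  -- `face j` is the set of pairs `(s, r)` such that the residual `r` describes a point of the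
  -- `j`-th face of the orthant with vertex `y + s`, ties being broken by the smallest index.
  let face : Fin d → Set (ℝ × (Fin d → ℝ)) := fun j =>
    {q | ∀ k, q.2 k + c j k * (y j + q.1) ≤ y k + q.1 ∧
      (k < j → q.2 k + c j k * (y j + q.1) < y k + q.1)}
  have hface : ∀ j, MeasurableSet (face j) := fun j => by
    have e : face j = ⋂ k, ({q | q.2 k + c j k * (y j + q.1) ≤ y k + q.1} ∩
        {q | k < j → q.2 k + c j k * (y j + q.1) < y k + q.1}) := by
      ext q; simp [face]
    rw [e]
    refine MeasurableSet.iInter fun k => (measurableSet_le (by fun_prop) (by fun_prop)).inter ?_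
    by_cases hkj : k < j
    · simp only [hkj, true_imp_iff]
      exact measurableSet_lt (by fun_prop) (by fun_prop)
    · simp [hkj]
  let g : Fin d → ℝ → ENNReal := fun j s => μ {x | (s, R j x) ∈ face j}
  have hslice : ∀ j s, MeasurableSet {x | (s, R j x) ∈ face j} := fun j s =>
    (hface j).preimage (measurable_const.prodMk (hR j))
  -- The outward prisms over the faces are disjoint.
  have hprism : ∀ s, ∑ j, gaussianReal 0 (v j) (Set.Ioi (y j + s)) * g j s ≤ 1 := by
    intro s
    let W : Fin d → Set (Fin d → ℝ) := fun j => {x | y j + s < x j} ∩ {x | (s, R j x) ∈ face j}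
    have hWm : ∀ j, MeasurableSet (W j) := fun j =>
      (measurableSet_lt measurable_const (measurable_pi_apply j)).inter (hslice j s)
    have hW : ∀ j, gaussianReal 0 (v j) (Set.Ioi (y j + s)) * g j s = μ (W j) := fun j => by
      have h := (hind j).measure_inter_preimage_eq_mul (Set.Ioi (y j + s)) (Prod.mk s ⁻¹' face j)
        measurableSet_Ioi (measurable_prodMk_left (hface j))
      rw [← hv j, Measure.map_apply (measurable_pi_apply j) measurableSet_Ioi]
      exact h.symm
    have hlt : ∀ j k, j < k → Disjoint (W j) (W k) := by
      intro j k hjk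
      refine Set.disjoint_left.2 fun x hxj hxk => ?_
      have h1 : y j + s < x j := hxj.1
      have h2 : y k + s < x k := hxk.1
      have h3 : x k - c j k * x j + c j k * (y j + s) ≤ y k + s := (hxj.2 k).1
      have h4 : x j - c k j * x k + c k j * (y k + s) < y j + s := (hxk.2 j).2 hjk
      have h5 := hcc j k
      have ha : 0 < x j - (y j + s) := by linarith
      have hb : 0 < x k - (y k + s) := by linarith
      have h6 : x k - (y k + s) ≤ c j k * (x j - (y j + s)) := by linarith
      have h7 : x j - (y j + s) < c k j * (x k - (y k + s)) := by linarith
      have h8 : 0 < c j k := pos_of_mul_pos_left (hb.trans_le h6) ha.le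
      have h9 := mul_lt_mul_of_pos_left h7 h8
      have h10 := mul_le_mul_of_nonneg_right h5 hb.le
      linarith
    calc ∑ j, gaussianReal 0 (v j) (Set.Ioi (y j + s)) * g j s = ∑ j, μ (W j) :=
          Finset.sum_congr rfl fun j _ => hW j
      _ = μ (⋃ j ∈ Finset.univ, W j) := by
          refine (measure_biUnion_finset (fun j _ k _ hjk => ?_) fun j _ => hWm j).symm
          rcases lt_or_gt_of_ne hjk with h | h
          · exact hlt j k h
          · exact (hlt k j h).symm
      _ ≤ 1 := prob_le_one
  have hbound : ∀ s, ∑ j, gaussianPDF 0 (v j) (y j + s) * g j s ≤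
      ENNReal.ofReal (1 / σ * (√(2 * Real.log d) + 2)) := by
    intro s
    have h := sum_gaussianPDFReal_mul_le hd hσ hσv (fun j => y j + s) (fun j => (g j s).toReal)
      (fun j => ENNReal.toReal_nonneg) (fun j => ENNReal.toReal_mono ENNReal.one_ne_top prob_le_one)
      (by
        have h := ENNReal.toReal_mono ENNReal.one_ne_top (hprism s)
        rw [ENNReal.toReal_sum fun j _ => ENNReal.mul_ne_top (measure_ne_top _ _)
          (measure_ne_top _ _)] at h
        simpa using h)
    refine le_trans (le_of_eq ?_) (ENNReal.ofReal_le_ofReal h)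
    rw [ENNReal.ofReal_sum_of_nonneg fun j _ => mul_nonneg (gaussianPDFReal_nonneg _ _ _)
      ENNReal.toReal_nonneg]
    refine Finset.sum_congr rfl fun j _ => ?_
    rw [ENNReal.ofReal_mul (gaussianPDFReal_nonneg _ _ _),
      ENNReal.ofReal_toReal (measure_ne_top _ _), gaussianPDF]
  have hgm : ∀ j, Measurable (g j) := fun j =>
    measurable_measure_prodMk_left (((hface j).preimage
      (measurable_fst.prodMk ((hR j).comp measurable_snd)) :
        MeasurableSet {q : ℝ × (Fin d → ℝ) | (q.1, R j q.2) ∈ face j}))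
  let E : Fin d → Set (Fin d → ℝ) := fun j =>
    {x | x j - y j ∈ Set.Ioc 0 t ∧ (x j - y j, R j x) ∈ face j}
  have hE : ∀ j, μ (E j) = ∫⁻ s in Set.Ioc 0 t, gaussianPDF 0 (v j) (y j + s) * g j s := by
    intro j
    let S : Set (ℝ × (Fin d → ℝ)) := {q | q.1 - y j ∈ Set.Ioc 0 t ∧ (q.1 - y j, q.2) ∈ face j}
    have hS : MeasurableSet S :=
      (measurableSet_Ioc.preimage (measurable_fst.sub_const _)).inter
        ((hface j).preimage ((measurable_fst.sub_const _).prodMk measurable_snd))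
    have h := measure_pair_mem_eq_lintegral_gaussianPDF (measurable_pi_apply j) (hR j) (hvne j)
      (hv j) (hind j) hS
    change μ (E j) = _ at h
    rw [h, ← lintegral_add_left_eq_self _ (y j), ← lintegral_indicator measurableSet_Ioc]
    refine lintegral_congr fun s => ?_
    by_cases hs : s ∈ Set.Ioc 0 t
    · rw [Set.indicator_of_mem hs]
      congr 2
      ext x
      simp only [S, Set.mem_ofPred_eq, add_sub_cancel_left, hs, true_and]
    · rw [Set.indicator_of_notMem hs]
      have : {x | (y j + s, R j x) ∈ S} = ∅ := by
        ext x
        simp only [S, Set.mem_ofPred_eq, add_sub_cancel_left, hs, false_and, Set.mem_empty_iff_false]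
      rw [this, measure_empty, mul_zero]
  have hcover : {x : Fin d → ℝ | ∀ j, x j ≤ y j + t} \ {x | ∀ j, x j ≤ y j} ⊆
      ⋃ j ∈ Finset.univ, E j := by
    rintro x ⟨hxt, hx0⟩
    simp only [Set.mem_ofPred_eq, not_forall, not_le] at hxt hx0
    obtain ⟨i, hi⟩ := hx0
    obtain ⟨m, -, hm⟩ := Finset.exists_max_image Finset.univ (fun k => x k - y k)
      ⟨i, Finset.mem_univ i⟩
    obtain ⟨j, hj, hjmin⟩ := Finset.exists_min_image
      (Finset.univ.filter fun k => x k - y k = x m - y m) id ⟨m, by simp⟩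
    simp only [Finset.mem_filter, Finset.mem_univ, true_and, id_eq, true_imp_iff] at hj hjmin hm
    have hle : ∀ k, x k - y k ≤ x j - y j := fun k => by rw [hj]; exact hm k
    refine Set.mem_biUnion (Finset.mem_coe.2 (Finset.mem_univ j))
      ⟨⟨by linarith [hle i], by linarith [hxt j]⟩, fun k => ⟨?_, fun hkj => ?_⟩⟩
    · simp only [R]
      rw [add_sub_cancel, sub_add_cancel]
      linarith [hle k]
    · simp only [R]
      rw [add_sub_cancel, sub_add_cancel]
      have : x k - y k ≠ x j - y j := fun h => absurd (hjmin k (h.trans hj)) (not_le.2 hkj)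
      linarith [lt_of_le_of_ne (hle k) this]
  have hdiff : μ ({x : Fin d → ℝ | ∀ j, x j ≤ y j + t} \ {x | ∀ j, x j ≤ y j}) ≤
      ENNReal.ofReal (t / σ * (√(2 * Real.log d) + 2)) := by
    calc _ ≤ μ (⋃ j ∈ Finset.univ, E j) := measure_mono hcover
      _ ≤ ∑ j, μ (E j) := measure_biUnion_finset_le _ _
      _ = ∫⁻ s in Set.Ioc 0 t, ∑ j, gaussianPDF 0 (v j) (y j + s) * g j s := by
          rw [lintegral_finsetSum]
          · exact Finset.sum_congr rfl fun j _ => hE j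
          · exact fun j _ => ((measurable_gaussianPDF _ _).comp (measurable_const_add _)).mul (hgm j)
      _ ≤ ∫⁻ s in Set.Ioc 0 t, ENNReal.ofReal (1 / σ * (√(2 * Real.log d) + 2)) :=
          lintegral_mono fun s => hbound s
      _ = _ := by
          rw [setLIntegral_const, Real.volume_Ioc, ← ENNReal.ofReal_mul (by positivity)]
          congr 1
          ring
  have hsub : {x : Fin d → ℝ | ∀ j, x j ≤ y j} ⊆ {x | ∀ j, x j ≤ y j + t} :=
    fun x hx j => (hx j).trans (by linarith)
  have hm0 : MeasurableSet {x : Fin d → ℝ | ∀ j, x j ≤ y j} := by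
    rw [Set.ofPred_forall]
    exact MeasurableSet.iInter fun j => measurableSet_le (measurable_pi_apply j) measurable_const
  have hreal := measureReal_sdiff hsub hm0 (μ := μ)
  simp only [Measure.real] at hreal
  rw [← hreal, abs_of_nonneg ENNReal.toReal_nonneg]
  exact ENNReal.toReal_le_of_le_ofReal (by positivity) hdiff
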